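/- arXiv:2507.17878 — 2 statements merged into one kernel-verified Lean document; each statement's English description precedes it below -/
import Mathlib

section
/- Let v_1, …, v_{2^d} be a bijective enumeration of 𝔽₂^d and let H_1, …, H_{2^d} be 𝔽₂-linear subspaces of 𝔽₂^d such that for each i, v_i ∈ H_i, and for each i and each j < i, v_j ∉ H_i. Then Σ_{i=1}^{2^d} |H_i| ≤ 2 · 3^d. -/
/-- The squarefree monomial `∏ s ∈ S, x s`, as a function on `𝔽₂^d`. -/
def monomialFun {d : ℕ} (S : Finset (Fin d)) : (Fin d → ZMod 2) → ZMod 2 :=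
  fun x => ∏ s ∈ S, x s

/-- The functions on `𝔽₂^d` given by polynomials of degree at most `m`. -/
def polyFun (d m : ℕ) : Submodule (ZMod 2) ((Fin d → ZMod 2) → ZMod 2) :=
  Submodule.span (ZMod 2) (monomialFun '' {S : Finset (Fin d) | S.card ≤ m})

theorem monomialFun_mem_polyFun {d m : ℕ} {S : Finset (Fin d)} (hS : S.card ≤ m) :
    monomialFun S ∈ polyFun d m :=
  Submodule.subset_span ⟨S, hS, rfl⟩

theorem polyFun_mono {d m n : ℕ} (h : m ≤ n) : polyFun d m ≤ polyFun d n :=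
  Submodule.span_mono (Set.image_mono fun _ hS => le_trans hS h)

theorem apply_mul_monomialFun {d : ℕ} (i : Fin d) (S : Finset (Fin d)) :
    (fun x => x i) * monomialFun S = monomialFun (insert i S) := by
  have idem : ∀ a : ZMod 2, a * a = a := by decide
  funext x
  by_cases hi : i ∈ S
  · rw [Finset.insert_eq_of_mem hi]
    simp only [Pi.mul_apply, monomialFun]
    rw [← Finset.mul_prod_erase S x hi, ← mul_assoc, idem]
  · simp [monomialFun, Finset.prod_insert hi]

theorem coord_mul_mem_polyFun {d m : ℕ} (i : Fin d) {f : (Fin d → ZMod 2) → ZMod 2}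
    (hf : f ∈ polyFun d m) : (fun x => x i) * f ∈ polyFun d (m + 1) := by
  have key : polyFun d m ≤
      (polyFun d (m + 1)).comap (LinearMap.mulLeft (ZMod 2) (fun x : Fin d → ZMod 2 => x i)) := by
    refine Submodule.span_le.2 ?_
    rintro _ ⟨S, hS, rfl⟩
    change (fun x => x i) * monomialFun S ∈ polyFun d (m + 1)
    rw [apply_mul_monomialFun]
    exact monomialFun_mem_polyFun
      ((Finset.card_insert_le i S).trans (Nat.succ_le_succ hS))
  exact key hf

theorem one_add_linear_mul_mem_polyFun {d m : ℕ} (l : (Fin d → ZMod 2) →ₗ[ZMod 2] ZMod 2)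
    {f : (Fin d → ZMod 2) → ZMod 2} (hf : f ∈ polyFun d m) :
    (fun x => (1 + l x) * f x) ∈ polyFun d (m + 1) := by
  have expand : (fun x => (1 + l x) * f x) =
      f + ∑ i, l (fun j => if i = j then 1 else 0) • ((fun x => x i) * f) := by
    funext x
    rw [LinearMap.pi_apply_eq_sum_univ l x]
    simp only [Pi.add_apply, Finset.sum_apply, Pi.smul_apply, Pi.mul_apply, smul_eq_mul,
      add_mul, one_mul, Finset.sum_mul]
    congr 1
    exact Finset.sum_congr rfl fun i _ => by ring
  rw [expand]
  exact add_mem (polyFun_mono m.le_succ hf)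
    (sum_mem fun i _ => Submodule.smul_mem _ _ (coord_mul_mem_polyFun i hf))

theorem prod_one_add_linear_mem_polyFun {d : ℕ} {ι : Type*} (s : Finset ι)
    (l : ι → (Fin d → ZMod 2) →ₗ[ZMod 2] ZMod 2) :
    (fun x => ∏ j ∈ s, (1 + l j x)) ∈ polyFun d s.card := by
  classical
  induction s using Finset.induction_on with
  | empty => exact monomialFun_mem_polyFun (S := ∅) le_rfl
  | insert a s ha ih =>
    simp only [Finset.prod_insert ha, Finset.card_insert_of_notMem ha]
    exact one_add_linear_mul_mem_polyFun (l a) ih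

open Classical in
theorem indicator_mem_polyFun {d : ℕ} (H : Submodule (ZMod 2) (Fin d → ZMod 2)) :
    (fun x => if x ∈ H then 1 else 0) ∈ polyFun d (d - Module.finrank (ZMod 2) H) := by
  have hcodim : Module.finrank (ZMod 2) ((Fin d → ZMod 2) ⧸ H) =
      d - Module.finrank (ZMod 2) H := by
    have := H.finrank_quotient_add_finrank
    rw [Module.finrank_fin_fun] at this
    omega
  let b := Module.finBasis (ZMod 2) ((Fin d → ZMod 2) ⧸ H)
  have hprod := prod_one_add_linear_mem_polyFun Finset.univ fun j => b.coord j ∘ₗ H.mkQ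
  rw [Finset.card_univ, Fintype.card_fin] at hprod
  rw [← hcodim]
  convert hprod using 2 with x
  by_cases hx : x ∈ H
  · simp [hx, (Submodule.Quotient.mk_eq_zero H).2 hx]
  · have hne : b.repr (H.mkQ x) ≠ 0 := by simpa using hx
    obtain ⟨j, hj⟩ := Finsupp.ne_iff.1 hne
    have eq_one : ∀ a : ZMod 2, a ≠ 0 → 1 + a = 0 := by decide
    rw [if_neg hx, Finset.prod_eq_zero (Finset.mem_univ j)]
    exact eq_one _ hj

theorem exists_coeff_of_mem_polyFun {d m : ℕ} {f : (Fin d → ZMod 2) → ZMod 2}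
    (hf : f ∈ polyFun d m) :
    ∃ c : Finset (Fin d) → ZMod 2, (∀ S, c S ≠ 0 → S.card ≤ m) ∧
      ∀ x, f x = ∑ S, c S * monomialFun S x := by
  obtain ⟨c, hc, rfl⟩ := (Finsupp.mem_span_image_iff_linearCombination (ZMod 2)).1 hf
  refine ⟨c, fun S hS => hc (Finsupp.mem_support_iff.2 hS), fun x => ?_⟩
  rw [Finsupp.linearCombination_apply, Finsupp.sum_fintype _ _ (by simp)]
  simp

theorem sum_two_pow_sub_card (d : ℕ) : ∑ S : Finset (Fin d), 2 ^ (d - S.card) = 3 ^ d := by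
  simpa using Fin.sum_pow_mul_eq_add_pow (n := d) (1 : ℕ) 2

/-- A nonzero determinant has a nonzero term in its Leibniz expansion. -/
theorem Matrix.exists_perm_forall_ne_zero {n R : Type*} [Fintype n] [DecidableEq n] [CommRing R]
    {M : Matrix n n R} (hM : M.det ≠ 0) : ∃ σ : Equiv.Perm n, ∀ i, M (σ i) i ≠ 0 := by
  rw [Matrix.det_apply] at hM
  obtain ⟨σ, -, hσ⟩ := Finset.exists_ne_zero_of_sum_ne_zero hM
  refine ⟨σ, fun i hi => hσ ?_⟩
  have hprod : ∏ j, M (σ j) j = 0 := Finset.prod_eq_zero (Finset.mem_univ i) hi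
  rw [hprod, smul_zero]

open Classical in
/-- The sharp form of the bound: the indicator functions of the `H i` form a unitriangular system,
so they can be matched with squarefree monomials of degree at most the codimension of `H i`. -/
theorem sum_card_submodule_le_three_pow (d : ℕ) (v : Fin (2 ^ d) → (Fin d → ZMod 2))
    (H : Fin (2 ^ d) → Submodule (ZMod 2) (Fin d → ZMod 2))
    (h1 : ∀ i, v i ∈ H i) (h2 : ∀ i j : Fin (2 ^ d), j < i → v j ∉ H i) :
    ∑ i, Nat.card (H i) ≤ 3 ^ d := by
  choose c hc hcv using fun i => exists_coeff_of_mem_polyFun (indicator_mem_polyFun (H i))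
  let e : Fin (2 ^ d) ≃ Finset (Fin d) := Fintype.equivOfCardEq (by simp)
  let M : Matrix (Fin (2 ^ d)) (Fin (2 ^ d)) (ZMod 2) := Matrix.of fun i j => c i (e j)
  let E : Matrix (Fin (2 ^ d)) (Fin (2 ^ d)) (ZMod 2) :=
    Matrix.of fun j k => monomialFun (e j) (v k)
  have hME : ∀ i k, (M * E) i k = if v k ∈ H i then 1 else 0 := fun i k => by
    rw [hcv i (v k), ← e.sum_comp]
    rfl
  have hdet : (M * E).det = 1 := by
    rw [Matrix.det_of_isUpperTriangular fun i j hij => by rw [hME, if_neg (h2 i j hij)]]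
    exact Finset.prod_eq_one fun i _ => by rw [hME, if_pos (h1 i)]
  have hM : M.det ≠ 0 := fun h => by simp [Matrix.det_mul, h] at hdet
  obtain ⟨σ, hσ⟩ := Matrix.exists_perm_forall_ne_zero hM
  rw [← sum_two_pow_sub_card, ← e.sum_comp, ← Equiv.sum_comp σ]
  refine Finset.sum_le_sum fun i _ => ?_
  have hcard := hc (σ i) (e i) (hσ i)
  have hfin : Module.finrank (ZMod 2) (H (σ i)) ≤ d := by
    simpa using (H (σ i)).finrank_le
  rw [Module.natCard_eq_pow_finrank (K := ZMod 2), Nat.card_zmod]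
  exact Nat.pow_le_pow_right two_pos (by omega)

/-- If `v` bijectively enumerates `𝔽₂^d` and `H i` are subspaces with
`v i ∈ H i` and `v j ∉ H i` for `j < i`, then `∑ i, |H i| ≤ 2 * 3 ^ d`. -/
theorem statement4 (d : ℕ) (v : Fin (2 ^ d) → (Fin d → ZMod 2))
    (hv : Function.Bijective v)
    (H : Fin (2 ^ d) → Submodule (ZMod 2) (Fin d → ZMod 2))
    (h1 : ∀ i, v i ∈ H i)
    (h2 : ∀ i j : Fin (2 ^ d), j < i → v j ∉ H i) :
    ∑ i, Nat.card (H i) ≤ 2 * 3 ^ d :=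
  (sum_card_submodule_le_three_pow d v H h1 h2).trans (Nat.le_mul_of_pos_left _ two_pos)
end

section
/- Let v_1, …, v_n be distinct vectors in 𝔽₂^d and let H_1, …, H_n be 𝔽₂-linear subspaces of 𝔽₂^d such that for each i, v_i ∈ H_i, and for each i and each j < i, v_j ∉ H_i. Then for every natural number b ≤ d, the number of indices i ∈ [n] with dim H_i ≥ d − b (equivalently, with codimension of H_i at most b) is at most Σ_{r=0}^{b} binom(d, r). -/
/-- The functions on `𝔽₂^d` spanned by the squarefree monomials of degree at most `b`. -/
def squarefreePolys (d b : ℕ) : Submodule (ZMod 2) ((Fin d → ZMod 2) → ZMod 2) :=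
  Submodule.span (ZMod 2)
    ((fun (S : Finset (Fin d)) (x : Fin d → ZMod 2) => ∏ i ∈ S, x i) '' {S | S.card ≤ b})

lemma squarefreePolys_mono (d : ℕ) {a b : ℕ} (h : a ≤ b) :
    squarefreePolys d a ≤ squarefreePolys d b :=
  Submodule.span_mono (Set.image_mono fun _ hS => le_trans hS h)

lemma finrank_squarefreePolys_le (d b : ℕ) :
    Module.finrank (ZMod 2) (squarefreePolys d b) ≤ ∑ r ∈ Finset.range (b + 1), d.choose r := by
  classical
  have hset : {S : Finset (Fin d) | S.card ≤ b} =
      ((Finset.range (b + 1)).biUnion fun r => Finset.powersetCard r Finset.univ :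
        Finset (Finset (Fin d))) := by
    ext S
    simp [Finset.mem_powersetCard]
  unfold squarefreePolys
  rw [hset, ← Finset.coe_image]
  refine (finrank_span_finset_le_card _).trans
    (Finset.card_image_le.trans (Finset.card_biUnion_le.trans (le_of_eq ?_)))
  simp

lemma prod_mul_prod_zmod_two {ι : Type*} [DecidableEq ι] (S T : Finset ι) (x : ι → ZMod 2) :
    (∏ i ∈ S, x i) * ∏ i ∈ T, x i = ∏ i ∈ S ∪ T, x i := by
  have hsq : ∀ a : ZMod 2, a * a = a := by decide
  rw [← Finset.prod_union_inter, ← Finset.prod_sdiff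
    (Finset.inter_subset_left.trans Finset.subset_union_left : S ∩ T ⊆ S ∪ T), mul_assoc,
    ← Finset.prod_mul_distrib]
  simp only [hsq]

lemma mul_mem_squarefreePolys {d a b : ℕ} {f g : (Fin d → ZMod 2) → ZMod 2}
    (hf : f ∈ squarefreePolys d a) (hg : g ∈ squarefreePolys d b) :
    f * g ∈ squarefreePolys d (a + b) := by
  classical
  have h := Submodule.mul_mem_mul hf hg
  unfold squarefreePolys at h
  rw [Submodule.span_mul_span] at h
  refine Submodule.span_mono ?_ h
  rintro _ ⟨_, ⟨S, hS, rfl⟩, _, ⟨T, hT, rfl⟩, rfl⟩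
  exact ⟨S ∪ T, (Finset.card_union_le S T).trans (add_le_add hS hT),
    funext fun x => (prod_mul_prod_zmod_two S T x).symm⟩

lemma one_mem_squarefreePolys (d b : ℕ) : 1 ∈ squarefreePolys d b :=
  Submodule.subset_span ⟨∅, by simp, by ext; simp⟩

lemma linear_mem_squarefreePolys {d : ℕ} (l : (Fin d → ZMod 2) →ₗ[ZMod 2] ZMod 2) :
    ⇑l ∈ squarefreePolys d 1 := by
  have h : ⇑l = ∑ i, l (Pi.single i 1) • fun x : Fin d → ZMod 2 => x i := by
    ext x
    rw [LinearMap.pi_apply_eq_sum_univ l x]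
    simp only [Finset.sum_apply, Pi.smul_apply, smul_eq_mul]
    refine Finset.sum_congr rfl fun i _ => ?_
    rw [mul_comm]
    congr 2
    ext j
    simp [Pi.single_apply, eq_comm]
  rw [h]
  exact Submodule.sum_mem _ fun i _ => Submodule.smul_mem _ _
    (Submodule.subset_span ⟨{i}, by simp, by ext; simp⟩)

lemma prod_mem_squarefreePolys {d : ℕ} {ι : Type*} (s : Finset ι)
    (f : ι → (Fin d → ZMod 2) → ZMod 2) (hf : ∀ i ∈ s, f i ∈ squarefreePolys d 1) :
    ∏ i ∈ s, f i ∈ squarefreePolys d s.card := by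
  classical
  induction s using Finset.induction_on with
  | empty => simpa using one_mem_squarefreePolys d 0
  | insert a s ha ih =>
    rw [Finset.prod_insert ha, Finset.card_insert_of_notMem ha, add_comm]
    exact mul_mem_squarefreePolys (hf a (by simp))
      (ih fun i hi => hf i (Finset.mem_insert_of_mem hi))

/-- The indicator function of a subspace of codimension at most `b` has degree at most `b`. -/
lemma exists_indicator_mem_squarefreePolys {d b : ℕ} (H : Submodule (ZMod 2) (Fin d → ZMod 2))
    (hH : d - b ≤ Module.finrank (ZMod 2) H) :
    ∃ f ∈ squarefreePolys d b, (∀ x ∈ H, f x = 1) ∧ ∀ x ∉ H, f x = 0 := by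
  let B := Module.finBasis (ZMod 2) ((Fin d → ZMod 2) ⧸ H)
  have hcard := H.finrank_quotient_add_finrank
  rw [Module.finrank_fin_fun] at hcard
  refine ⟨∏ k, (1 + ⇑(B.coord k ∘ₗ H.mkQ)), ?_, fun x hx => ?_, fun x hx => ?_⟩
  · refine squarefreePolys_mono d ?_ (prod_mem_squarefreePolys _ _ fun k _ =>
      Submodule.add_mem _ (one_mem_squarefreePolys d 1) (linear_mem_squarefreePolys _))
    rw [Finset.card_univ, Fintype.card_fin]
    omega
  · have hx0 : H.mkQ x = 0 := by simpa using hx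
    simp only [Finset.prod_apply, Pi.add_apply, Pi.one_apply, LinearMap.comp_apply, hx0, map_zero,
      add_zero, Finset.prod_const_one]
  · have hx0 : H.mkQ x ≠ 0 := by simpa using hx
    obtain ⟨k, hk⟩ : ∃ k, B.coord k (H.mkQ x) ≠ 0 := by
      by_contra! h
      exact hx0 (B.forall_coord_eq_zero_iff.mp h)
    have hone : ∀ a : ZMod 2, a ≠ 0 → 1 + a = 0 := by decide
    rw [Finset.prod_apply]
    exact Finset.prod_eq_zero (Finset.mem_univ k) (hone _ hk)

/-- Functions whose matrix of values at suitable points is unitriangular are linearly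
independent. -/
lemma linearIndependent_of_triangular_eval {K X ι : Type*} [Field K] [LinearOrder ι] [Fintype ι]
    (f : ι → X → K) (v : ι → X) (hdiag : ∀ i, f i (v i) = 1)
    (hlt : ∀ i j, j < i → f i (v j) = 0) : LinearIndependent K f := by
  rw [Fintype.linearIndependent_iff]
  intro g hg i
  induction i using WellFoundedLT.induction with
  | ind i ih =>
    have h := congrFun hg (v i)
    rw [Finset.sum_apply, Finset.sum_eq_single i] at h
    · simpa [hdiag i] using h
    · intro j _ hj
      rcases lt_or_gt_of_ne hj with hj | hj
      · simp [ih j hj]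
      · simp [hlt j i hj]
    · simp

/-- If the `v i` are distinct with `v i ∈ H i` and `v j ∉ H i` for `j < i`, then
for every `b ≤ d` the number of indices `i` with `dim H i ≥ d - b` is at most
`∑_{r=0}^{b} choose d r`. -/
theorem statement5 {n d : ℕ} (v : Fin n → (Fin d → ZMod 2)) (hv : Function.Injective v)
    (H : Fin n → Submodule (ZMod 2) (Fin d → ZMod 2))
    (h1 : ∀ i, v i ∈ H i)
    (h2 : ∀ i j : Fin n, j < i → v j ∉ H i)
    (b : ℕ) (hb : b ≤ d) :
    (Finset.univ.filter (fun i : Fin n => d - b ≤ Module.finrank (ZMod 2) (H i))).card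
      ≤ ∑ r ∈ Finset.range (b + 1), d.choose r := by
  classical
  choose f hf hf1 hf0 using fun i : {i : Fin n // d - b ≤ Module.finrank (ZMod 2) (H i)} =>
    exists_indicator_mem_squarefreePolys (H i) i.2
  have hli : LinearIndependent (ZMod 2) f :=
    linearIndependent_of_triangular_eval f (fun i => v i) (fun i => hf1 i _ (h1 i))
      fun i j hij => hf0 i _ (h2 i j hij)
  have hli' : LinearIndependent (ZMod 2)
      (fun i => (⟨f i, hf i⟩ : squarefreePolys d b)) :=
    LinearIndependent.of_comp (squarefreePolys d b).subtype hli
  rw [← Fintype.card_subtype]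
  exact hli'.fintype_card_le_finrank.trans (finrank_squarefreePolys_le d b)
end
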